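/- arXiv:2512.17177 — 8 statements merged into one kernel-verified Lean document; each statement's English description precedes it below -/
import Mathlib

section
/- Let S be a semigroup with a tight twisting Φ and let T⁰ be the associated 0-twisted semigroup. Then for all a,b ∈ S (viewed as nonzero elements of T⁰): a ≤_𝒥 b in T⁰ if and only if a ≤_𝒥 b in S. -/
namespace Stmt2

variable {α β : Type*}

/-- Green's `≤_ℛ` preorder for a binary operation `mul`. -/
def leR (mul : α → α → α) (a b : α) : Prop := a = b ∨ ∃ x, a = mul b x

/-- Green's `≤_ℒ` preorder for a binary operation `mul`. -/
def leL (mul : α → α → α) (a b : α) : Prop := a = b ∨ ∃ x, a = mul x b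

/-- Green's `≤_𝒥` preorder for a binary operation `mul`. -/
def leJ (mul : α → α → α) (a b : α) : Prop :=
  a = b ∨ (∃ x, a = mul x b) ∨ (∃ y, a = mul b y) ∨ ∃ x y, a = mul (mul x b) y

/-- Green's `ℛ` equivalence. -/
def grR (mul : α → α → α) (a b : α) : Prop := leR mul a b ∧ leR mul b a

/-- Green's `ℒ` equivalence. -/
def grL (mul : α → α → α) (a b : α) : Prop := leL mul a b ∧ leL mul b a

/-- Green's `𝒥` equivalence. -/
def grJ (mul : α → α → α) (a b : α) : Prop := leJ mul a b ∧ leJ mul b a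

/-- Green's `ℋ` equivalence. -/
def grH (mul : α → α → α) (a b : α) : Prop := grR mul a b ∧ grL mul a b

/-- Green's `𝒟` equivalence. -/
def grD (mul : α → α → α) (a b : α) : Prop := ∃ c, grR mul a c ∧ grL mul c b

/-- The `𝒟`-class of an element. -/
def Dclass (mul : α → α → α) (a : α) : Set α := {b | grD mul a b}

/-- The `ℋ`-class of an element. -/
def Hclass (mul : α → α → α) (a : α) : Set α := {b | grH mul a b}

/-- The set of idempotents `E(X)` of a subset `X`. -/
def idemSet (mul : α → α → α) (X : Set α) : Set α := {e ∈ X | mul e e = e}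

/-- A twisting on a semigroup `S`. -/
def Twisting {S : Type*} [Semigroup S] (Φ : S → S → ℕ) : Prop :=
  ∀ a b c : S, Φ a b + Φ (a * b) c = Φ a (b * c) + Φ b c

/-- A tight twisting. -/
def Tight {S : Type*} [Semigroup S] (Φ : S → S → ℕ) : Prop :=
  ∀ a b : S, (∃ a', a * b = a' * b ∧ Φ a' b = 0) ∧ ∃ b', a * b = a * b' ∧ Φ a b' = 0

/-- The multiplication of the twisted product `T = M ×_Φ^q S`. -/
def twMul {S M : Type*} [Semigroup S] [AddCommMonoid M] (Φ : S → S → ℕ) (q : M)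
    (x y : M × S) : M × S :=
  (x.1 + y.1 + Φ x.2 y.2 • q, x.2 * y.2)

/-- The multiplication of the `0`-twisted semigroup `T⁰` on `S ⊔ {0}`;
`none` plays the role of the zero element. -/
def zMul {S : Type*} [Semigroup S] (Φ : S → S → ℕ) : Option S → Option S → Option S
  | some a, some b => if Φ a b = 0 then some (a * b) else none
  | _, _ => none

/-- A `𝒟`-trivial additive commutative monoid. -/
def DTrivialAdd (M : Type*) [AddCommMonoid M] : Prop :=
  ∀ i j : M, (∃ c, i = j + c) → (∃ d, j = i + d) → i = j

/-- Condition (★) for the `𝒟`-class of `(j, a)` in `T = M ×_Φ^q S`. -/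
def CondStar {S M : Type*} [Semigroup S] [AddCommMonoid M]
    (Φ : S → S → ℕ) (q j : M) (a : S) : Prop :=
  (∃ e ∈ Dclass (· * ·) a, e * e = e ∧ 0 < Φ e e ∧ j = j + Φ e e • q) →
    ∀ f ∈ Dclass (· * ·) a, f * f = f → 0 < Φ f f → j = j + Φ f f • q

/-- `D₁ ≃ D₂`: a bijection preserving the `ℒ`- and `ℛ`-relations. -/
def DSimeq {α β : Type*} (mul₁ : α → α → α) (mul₂ : β → β → β)
    (D₁ : Set α) (D₂ : Set β) : Prop :=
  ∃ Θ : α → β, Set.BijOn Θ D₁ D₂ ∧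
    ∀ a ∈ D₁, ∀ b ∈ D₁,
      (grL mul₁ a b ↔ grL mul₂ (Θ a) (Θ b)) ∧ (grR mul₁ a b ↔ grR mul₂ (Θ a) (Θ b))

/-- `D₁ ≅ D₂`: a bijection preserving the `ℒ`- and `ℛ`-relations and the
(non)existence of idempotents in each `ℋ`-class. -/
def DCong {α β : Type*} (mul₁ : α → α → α) (mul₂ : β → β → β)
    (D₁ : Set α) (D₂ : Set β) : Prop :=
  ∃ Θ : α → β, (Set.BijOn Θ D₁ D₂ ∧
    ∀ a ∈ D₁, ∀ b ∈ D₁,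
      (grL mul₁ a b ↔ grL mul₂ (Θ a) (Θ b)) ∧ (grR mul₁ a b ↔ grR mul₂ (Θ a) (Θ b))) ∧
    ∀ a ∈ D₁,
      (idemSet mul₁ (Hclass mul₁ a ∩ D₁) = ∅ ↔
        idemSet mul₂ (Θ '' (Hclass mul₁ a ∩ D₁)) = ∅)

/-- For a tight twisting `Φ` on a semigroup `S`, and `a, b ∈ S` viewed
as nonzero elements of the `0`-twisted semigroup `T⁰`: `a ≤_𝒥 b` in `T⁰` iff `a ≤_𝒥 b`
in `S`. -/
theorem statement2 {S : Type*} [Semigroup S] (Φ : S → S → ℕ)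
    (hco : Twisting Φ) (hti : Tight Φ) (a b : S) :
    leJ (zMul Φ) (some a) (some b) ↔ leJ (· * ·) a b := by
  have key : ∀ u v w : S, some w = zMul Φ (some u) (some v) ↔ Φ u v = 0 ∧ w = u * v := by
    intro u v w
    by_cases h : Φ u v = 0 <;> simp [zMul, h]
  have hn1 : ∀ v : Option S, zMul Φ none v = none := fun v => by simp [zMul]
  have hn2 : ∀ v : Option S, zMul Φ v none = none := fun v => by cases v <;> simp [zMul]
  constructor
  · rintro (h | ⟨x, h⟩ | ⟨y, h⟩ | ⟨x, y, h⟩)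
    · exact Or.inl (Option.some.inj h)
    · rcases x with _ | x
      · simp [hn1] at h
      · exact Or.inr (Or.inl ⟨x, ((key _ _ _).1 h).2⟩)
    · rcases y with _ | y
      · simp [hn2] at h
      · exact Or.inr (Or.inr (Or.inl ⟨y, ((key _ _ _).1 h).2⟩))
    · rcases x with _ | x
      · simp [hn1] at h
      rcases y with _ | y
      · simp [hn2] at h
      rcases hz : zMul Φ (some x) (some b) with _ | z
      · simp [hz, hn1] at h
      · rw [hz] at h
        have h1 := ((key _ _ _).1 hz.symm).2
        have h2 := ((key _ _ _).1 h).2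
        exact Or.inr (Or.inr (Or.inr ⟨x, y, by rw [h2, h1]⟩))
  · rintro (h | ⟨x, h⟩ | ⟨y, h⟩ | ⟨x, y, h⟩)
    · exact Or.inl (congrArg some h)
    · obtain ⟨x', h1, h2⟩ := (hti x b).1
      exact Or.inr (Or.inl ⟨some x', (key _ _ _).2 ⟨h2, h.trans h1⟩⟩)
    · obtain ⟨y', h1, h2⟩ := (hti b y).2
      exact Or.inr (Or.inr (Or.inl ⟨some y', (key _ _ _).2 ⟨h2, h.trans h1⟩⟩))
    · obtain ⟨x', h1, h2⟩ := (hti x b).1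
      obtain ⟨y', h3, h4⟩ := (hti (x * b) y).2
      refine Or.inr (Or.inr (Or.inr ⟨some x', some y', ?_⟩))
      rw [← (key x' b (x * b)).2 ⟨h2, h1⟩]
      exact (key _ _ _).2 ⟨h4, h.trans h3⟩

end Stmt2
end

section
/- Let S be a semigroup with a tight twisting Φ and let T⁰ be the associated 0-twisted semigroup. Then for all a,b ∈ S (viewed as nonzero elements of T⁰): a ≤_ℛ b in T⁰ if and only if a ≤_ℛ b in S, and a ≤_ℒ b in T⁰ if and only if a ≤_ℒ b in S. -/
namespace Stmt3

variable {α β : Type*}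

/-- Green's `≤_ℛ` preorder for a binary operation `mul`. -/
def leR (mul : α → α → α) (a b : α) : Prop := a = b ∨ ∃ x, a = mul b x

/-- Green's `≤_ℒ` preorder for a binary operation `mul`. -/
def leL (mul : α → α → α) (a b : α) : Prop := a = b ∨ ∃ x, a = mul x b

/-- Green's `≤_𝒥` preorder for a binary operation `mul`. -/
def leJ (mul : α → α → α) (a b : α) : Prop :=
  a = b ∨ (∃ x, a = mul x b) ∨ (∃ y, a = mul b y) ∨ ∃ x y, a = mul (mul x b) y

/-- Green's `ℛ` equivalence. -/
def grR (mul : α → α → α) (a b : α) : Prop := leR mul a b ∧ leR mul b a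

/-- Green's `ℒ` equivalence. -/
def grL (mul : α → α → α) (a b : α) : Prop := leL mul a b ∧ leL mul b a

/-- Green's `𝒥` equivalence. -/
def grJ (mul : α → α → α) (a b : α) : Prop := leJ mul a b ∧ leJ mul b a

/-- Green's `ℋ` equivalence. -/
def grH (mul : α → α → α) (a b : α) : Prop := grR mul a b ∧ grL mul a b

/-- Green's `𝒟` equivalence. -/
def grD (mul : α → α → α) (a b : α) : Prop := ∃ c, grR mul a c ∧ grL mul c b

/-- The `𝒟`-class of an element. -/
def Dclass (mul : α → α → α) (a : α) : Set α := {b | grD mul a b}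

/-- The `ℋ`-class of an element. -/
def Hclass (mul : α → α → α) (a : α) : Set α := {b | grH mul a b}

/-- The set of idempotents `E(X)` of a subset `X`. -/
def idemSet (mul : α → α → α) (X : Set α) : Set α := {e ∈ X | mul e e = e}

/-- A twisting on a semigroup `S`. -/
def Twisting {S : Type*} [Semigroup S] (Φ : S → S → ℕ) : Prop :=
  ∀ a b c : S, Φ a b + Φ (a * b) c = Φ a (b * c) + Φ b c

/-- A tight twisting. -/
def Tight {S : Type*} [Semigroup S] (Φ : S → S → ℕ) : Prop :=
  ∀ a b : S, (∃ a', a * b = a' * b ∧ Φ a' b = 0) ∧ ∃ b', a * b = a * b' ∧ Φ a b' = 0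

/-- The multiplication of the twisted product `T = M ×_Φ^q S`. -/
def twMul {S M : Type*} [Semigroup S] [AddCommMonoid M] (Φ : S → S → ℕ) (q : M)
    (x y : M × S) : M × S :=
  (x.1 + y.1 + Φ x.2 y.2 • q, x.2 * y.2)

/-- The multiplication of the `0`-twisted semigroup `T⁰` on `S ⊔ {0}`;
`none` plays the role of the zero element. -/
def zMul {S : Type*} [Semigroup S] (Φ : S → S → ℕ) : Option S → Option S → Option S
  | some a, some b => if Φ a b = 0 then some (a * b) else none
  | _, _ => none

/-- A `𝒟`-trivial additive commutative monoid. -/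
def DTrivialAdd (M : Type*) [AddCommMonoid M] : Prop :=
  ∀ i j : M, (∃ c, i = j + c) → (∃ d, j = i + d) → i = j

/-- Condition (★) for the `𝒟`-class of `(j, a)` in `T = M ×_Φ^q S`. -/
def CondStar {S M : Type*} [Semigroup S] [AddCommMonoid M]
    (Φ : S → S → ℕ) (q j : M) (a : S) : Prop :=
  (∃ e ∈ Dclass (· * ·) a, e * e = e ∧ 0 < Φ e e ∧ j = j + Φ e e • q) →
    ∀ f ∈ Dclass (· * ·) a, f * f = f → 0 < Φ f f → j = j + Φ f f • q

/-- `D₁ ≃ D₂`: a bijection preserving the `ℒ`- and `ℛ`-relations. -/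
def DSimeq {α β : Type*} (mul₁ : α → α → α) (mul₂ : β → β → β)
    (D₁ : Set α) (D₂ : Set β) : Prop :=
  ∃ Θ : α → β, Set.BijOn Θ D₁ D₂ ∧
    ∀ a ∈ D₁, ∀ b ∈ D₁,
      (grL mul₁ a b ↔ grL mul₂ (Θ a) (Θ b)) ∧ (grR mul₁ a b ↔ grR mul₂ (Θ a) (Θ b))

/-- `D₁ ≅ D₂`: a bijection preserving the `ℒ`- and `ℛ`-relations and the
(non)existence of idempotents in each `ℋ`-class. -/
def DCong {α β : Type*} (mul₁ : α → α → α) (mul₂ : β → β → β)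
    (D₁ : Set α) (D₂ : Set β) : Prop :=
  ∃ Θ : α → β, (Set.BijOn Θ D₁ D₂ ∧
    ∀ a ∈ D₁, ∀ b ∈ D₁,
      (grL mul₁ a b ↔ grL mul₂ (Θ a) (Θ b)) ∧ (grR mul₁ a b ↔ grR mul₂ (Θ a) (Θ b))) ∧
    ∀ a ∈ D₁,
      (idemSet mul₁ (Hclass mul₁ a ∩ D₁) = ∅ ↔
        idemSet mul₂ (Θ '' (Hclass mul₁ a ∩ D₁)) = ∅)

/-- For a tight twisting `Φ` on a semigroup `S`, and `a, b ∈ S` viewed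
as nonzero elements of the `0`-twisted semigroup `T⁰`: `a ≤_ℛ b` in `T⁰` iff `a ≤_ℛ b`
in `S`, and `a ≤_ℒ b` in `T⁰` iff `a ≤_ℒ b` in `S`. -/
theorem statement3 {S : Type*} [Semigroup S] (Φ : S → S → ℕ)
    (hco : Twisting Φ) (hti : Tight Φ) (a b : S) :
    (leR (zMul Φ) (some a) (some b) ↔ leR (· * ·) a b) ∧
    (leL (zMul Φ) (some a) (some b) ↔ leL (· * ·) a b) := by
  refine ⟨⟨?_, ?_⟩, ⟨?_, ?_⟩⟩
  · rintro (h | ⟨x, h⟩)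
    · exact Or.inl (Option.some.inj h)
    · cases x with
      | none => simp [zMul] at h
      | some x =>
        by_cases h0 : Φ b x = 0
        · simp only [zMul, h0, if_true] at h
          exact Or.inr ⟨x, Option.some.inj h⟩
        · simp [zMul, h0] at h
  · rintro (h | ⟨x, h⟩)
    · exact Or.inl (congrArg some h)
    · obtain ⟨y, hy, h0⟩ := (hti b x).2
      refine Or.inr ⟨some y, ?_⟩
      simp only [zMul, h0, if_true]
      exact congrArg some (h.trans hy)
  · rintro (h | ⟨x, h⟩)
    · exact Or.inl (Option.some.inj h)
    · cases x with
      | none => simp [zMul] at h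
      | some x =>
        by_cases h0 : Φ x b = 0
        · simp only [zMul, h0, if_true] at h
          exact Or.inr ⟨x, Option.some.inj h⟩
        · simp [zMul, h0] at h
  · rintro (h | ⟨x, h⟩)
    · exact Or.inl (congrArg some h)
    · obtain ⟨y, hy, h0⟩ := (hti x b).1
      refine Or.inr ⟨some y, ?_⟩
      simp only [zMul, h0, if_true]
      exact congrArg some (h.trans hy)

end Stmt3
end

section
/- Let S be a semigroup with a tight twisting Φ and let T⁰ be the associated 0-twisted semigroup. Then for each Green equivalence 𝒦 ∈ {ℛ, ℒ, ℋ, 𝒟, 𝒥} and all x,y ∈ T⁰: x 𝒦 y in T⁰ if and only if either x = y = 0, or x,y ∈ S and x 𝒦 y in S. In other words, 𝒦^{T⁰} = 𝒦^S ∪ {(0,0)}. -/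
namespace Stmt4

variable {α β : Type*}

/-- Green's `≤_ℛ` preorder for a binary operation `mul`. -/
def leR (mul : α → α → α) (a b : α) : Prop := a = b ∨ ∃ x, a = mul b x

/-- Green's `≤_ℒ` preorder for a binary operation `mul`. -/
def leL (mul : α → α → α) (a b : α) : Prop := a = b ∨ ∃ x, a = mul x b

/-- Green's `≤_𝒥` preorder for a binary operation `mul`. -/
def leJ (mul : α → α → α) (a b : α) : Prop :=
  a = b ∨ (∃ x, a = mul x b) ∨ (∃ y, a = mul b y) ∨ ∃ x y, a = mul (mul x b) y

/-- Green's `ℛ` equivalence. -/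
def grR (mul : α → α → α) (a b : α) : Prop := leR mul a b ∧ leR mul b a

/-- Green's `ℒ` equivalence. -/
def grL (mul : α → α → α) (a b : α) : Prop := leL mul a b ∧ leL mul b a

/-- Green's `𝒥` equivalence. -/
def grJ (mul : α → α → α) (a b : α) : Prop := leJ mul a b ∧ leJ mul b a

/-- Green's `ℋ` equivalence. -/
def grH (mul : α → α → α) (a b : α) : Prop := grR mul a b ∧ grL mul a b

/-- Green's `𝒟` equivalence. -/
def grD (mul : α → α → α) (a b : α) : Prop := ∃ c, grR mul a c ∧ grL mul c b

/-- The `𝒟`-class of an element. -/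
def Dclass (mul : α → α → α) (a : α) : Set α := {b | grD mul a b}

/-- The `ℋ`-class of an element. -/
def Hclass (mul : α → α → α) (a : α) : Set α := {b | grH mul a b}

/-- The set of idempotents `E(X)` of a subset `X`. -/
def idemSet (mul : α → α → α) (X : Set α) : Set α := {e ∈ X | mul e e = e}

/-- A twisting on a semigroup `S`. -/
def Twisting {S : Type*} [Semigroup S] (Φ : S → S → ℕ) : Prop :=
  ∀ a b c : S, Φ a b + Φ (a * b) c = Φ a (b * c) + Φ b c

/-- A tight twisting. -/
def Tight {S : Type*} [Semigroup S] (Φ : S → S → ℕ) : Prop :=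
  ∀ a b : S, (∃ a', a * b = a' * b ∧ Φ a' b = 0) ∧ ∃ b', a * b = a * b' ∧ Φ a b' = 0

/-- The multiplication of the twisted product `T = M ×_Φ^q S`. -/
def twMul {S M : Type*} [Semigroup S] [AddCommMonoid M] (Φ : S → S → ℕ) (q : M)
    (x y : M × S) : M × S :=
  (x.1 + y.1 + Φ x.2 y.2 • q, x.2 * y.2)

/-- The multiplication of the `0`-twisted semigroup `T⁰` on `S ⊔ {0}`;
`none` plays the role of the zero element. -/
def zMul {S : Type*} [Semigroup S] (Φ : S → S → ℕ) : Option S → Option S → Option S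
  | some a, some b => if Φ a b = 0 then some (a * b) else none
  | _, _ => none

/-- A `𝒟`-trivial additive commutative monoid. -/
def DTrivialAdd (M : Type*) [AddCommMonoid M] : Prop :=
  ∀ i j : M, (∃ c, i = j + c) → (∃ d, j = i + d) → i = j

/-- Condition (★) for the `𝒟`-class of `(j, a)` in `T = M ×_Φ^q S`. -/
def CondStar {S M : Type*} [Semigroup S] [AddCommMonoid M]
    (Φ : S → S → ℕ) (q j : M) (a : S) : Prop :=
  (∃ e ∈ Dclass (· * ·) a, e * e = e ∧ 0 < Φ e e ∧ j = j + Φ e e • q) →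
    ∀ f ∈ Dclass (· * ·) a, f * f = f → 0 < Φ f f → j = j + Φ f f • q

/-- `D₁ ≃ D₂`: a bijection preserving the `ℒ`- and `ℛ`-relations. -/
def DSimeq {α β : Type*} (mul₁ : α → α → α) (mul₂ : β → β → β)
    (D₁ : Set α) (D₂ : Set β) : Prop :=
  ∃ Θ : α → β, Set.BijOn Θ D₁ D₂ ∧
    ∀ a ∈ D₁, ∀ b ∈ D₁,
      (grL mul₁ a b ↔ grL mul₂ (Θ a) (Θ b)) ∧ (grR mul₁ a b ↔ grR mul₂ (Θ a) (Θ b))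

/-- `D₁ ≅ D₂`: a bijection preserving the `ℒ`- and `ℛ`-relations and the
(non)existence of idempotents in each `ℋ`-class. -/
def DCong {α β : Type*} (mul₁ : α → α → α) (mul₂ : β → β → β)
    (D₁ : Set α) (D₂ : Set β) : Prop :=
  ∃ Θ : α → β, (Set.BijOn Θ D₁ D₂ ∧
    ∀ a ∈ D₁, ∀ b ∈ D₁,
      (grL mul₁ a b ↔ grL mul₂ (Θ a) (Θ b)) ∧ (grR mul₁ a b ↔ grR mul₂ (Θ a) (Θ b))) ∧
    ∀ a ∈ D₁,
      (idemSet mul₁ (Hclass mul₁ a ∩ D₁) = ∅ ↔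
        idemSet mul₂ (Θ '' (Hclass mul₁ a ∩ D₁)) = ∅)

theorem z_some {S : Type*} [Semigroup S] {Φ : S → S → ℕ} {p q : Option S} {a : S}
    (h : some a = zMul Φ p q) : ∃ b c, p = some b ∧ q = some c ∧ Φ b c = 0 ∧ a = b * c := by
  rcases p with _ | b <;> rcases q with _ | c <;> simp only [zMul, reduceCtorEq] at h
  split_ifs at h with h0
  exact ⟨b, c, rfl, rfl, h0, Option.some.inj h⟩

theorem z_mul {S : Type*} [Semigroup S] {Φ : S → S → ℕ} {b c : S} (h : Φ b c = 0) :
    zMul Φ (some b) (some c) = some (b * c) := by simp [zMul, h]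

theorem leR_z {S : Type*} [Semigroup S] {Φ : S → S → ℕ} (hti : Tight Φ) (a b : S) :
    leR (zMul Φ) (some a) (some b) ↔ leR (· * ·) a b := by
  constructor
  · rintro (h | ⟨x, h⟩)
    · exact Or.inl (Option.some.inj h)
    · obtain ⟨b', c, hb, rfl, _, rfl⟩ := z_some h
      cases hb
      exact Or.inr ⟨c, rfl⟩
  · rintro (rfl | ⟨x, rfl⟩)
    · exact Or.inl rfl
    · obtain ⟨x', h1, h2⟩ := (hti b x).2
      exact Or.inr ⟨some x', by rw [z_mul h2, ← h1]⟩

theorem leL_z {S : Type*} [Semigroup S] {Φ : S → S → ℕ} (hti : Tight Φ) (a b : S) :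
    leL (zMul Φ) (some a) (some b) ↔ leL (· * ·) a b := by
  constructor
  · rintro (h | ⟨x, h⟩)
    · exact Or.inl (Option.some.inj h)
    · obtain ⟨c, b', rfl, hb, _, rfl⟩ := z_some h
      cases hb
      exact Or.inr ⟨c, rfl⟩
  · rintro (rfl | ⟨x, rfl⟩)
    · exact Or.inl rfl
    · obtain ⟨x', h1, h2⟩ := (hti x b).1
      exact Or.inr ⟨some x', by rw [z_mul h2, ← h1]⟩

theorem leJ_z {S : Type*} [Semigroup S] {Φ : S → S → ℕ} (hti : Tight Φ) (a b : S) :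
    leJ (zMul Φ) (some a) (some b) ↔ leJ (· * ·) a b := by
  constructor
  · rintro (h | ⟨x, h⟩ | ⟨x, h⟩ | ⟨x, y, h⟩)
    · exact Or.inl (Option.some.inj h)
    · obtain ⟨c, b', rfl, hb, _, rfl⟩ := z_some h
      cases hb
      exact Or.inr (Or.inl ⟨c, rfl⟩)
    · obtain ⟨b', c, hb, rfl, _, rfl⟩ := z_some h
      cases hb
      exact Or.inr (Or.inr (Or.inl ⟨c, rfl⟩))
    · obtain ⟨d, c, hd, rfl, _, rfl⟩ := z_some h
      obtain ⟨e, b', rfl, hb, _, rfl⟩ := z_some hd.symm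
      cases hb
      exact Or.inr (Or.inr (Or.inr ⟨e, c, rfl⟩))
  · rintro (rfl | ⟨x, rfl⟩ | ⟨x, rfl⟩ | ⟨x, y, rfl⟩)
    · exact Or.inl rfl
    · obtain ⟨x', h1, h2⟩ := (hti x b).1
      exact Or.inr (Or.inl ⟨some x', by rw [z_mul h2, ← h1]⟩)
    · obtain ⟨x', h1, h2⟩ := (hti b x).2
      exact Or.inr (Or.inr (Or.inl ⟨some x', by rw [z_mul h2, ← h1]⟩))
    · obtain ⟨x', h1, h2⟩ := (hti x b).1
      obtain ⟨y', h3, h4⟩ := (hti (x * b) y).2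
      refine Or.inr (Or.inr (Or.inr ⟨some x', some y', ?_⟩))
      rw [z_mul h2, ← h1, z_mul h4, ← h3]

theorem leR_none {S : Type*} [Semigroup S] {Φ : S → S → ℕ} (a : S) :
    ¬ leR (zMul Φ) (some a) none := by
  rintro (h | ⟨x, h⟩)
  · cases h
  · obtain ⟨_, _, h, _⟩ := z_some h
    cases h

theorem leL_none {S : Type*} [Semigroup S] {Φ : S → S → ℕ} (a : S) :
    ¬ leL (zMul Φ) (some a) none := by
  rintro (h | ⟨x, h⟩)
  · cases h
  · obtain ⟨_, _, _, h, _⟩ := z_some h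
    cases h

theorem leJ_none {S : Type*} [Semigroup S] {Φ : S → S → ℕ} (a : S) :
    ¬ leJ (zMul Φ) (some a) none := by
  rintro (h | ⟨x, h⟩ | ⟨x, h⟩ | ⟨x, y, h⟩)
  · cases h
  · obtain ⟨_, _, _, h, _⟩ := z_some h
    cases h
  · obtain ⟨_, _, h, _⟩ := z_some h
    cases h
  · obtain ⟨_, _, h, _⟩ := z_some h
    obtain ⟨_, _, _, h, _⟩ := z_some h.symm
    cases h

/-- For a tight twisting `Φ` on a semigroup `S` and the associated
`0`-twisted semigroup `T⁰`: for each Green equivalence `𝒦 ∈ {ℛ, ℒ, ℋ, 𝒟, 𝒥}` and all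
`x, y ∈ T⁰`, `x 𝒦 y` in `T⁰` iff either `x = y = 0` or `x, y ∈ S` and `x 𝒦 y` in `S`;
that is, `𝒦^{T⁰} = 𝒦^S ∪ {(0,0)}`. -/
theorem statement4 {S : Type*} [Semigroup S] (Φ : S → S → ℕ)
    (hco : Twisting Φ) (hti : Tight Φ) (x y : Option S) :
    (grR (zMul Φ) x y ↔
      (x = none ∧ y = none) ∨ ∃ a b : S, x = some a ∧ y = some b ∧ grR (· * ·) a b) ∧
    (grL (zMul Φ) x y ↔
      (x = none ∧ y = none) ∨ ∃ a b : S, x = some a ∧ y = some b ∧ grL (· * ·) a b) ∧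
    (grH (zMul Φ) x y ↔
      (x = none ∧ y = none) ∨ ∃ a b : S, x = some a ∧ y = some b ∧ grH (· * ·) a b) ∧
    (grD (zMul Φ) x y ↔
      (x = none ∧ y = none) ∨ ∃ a b : S, x = some a ∧ y = some b ∧ grD (· * ·) a b) ∧
    (grJ (zMul Φ) x y ↔
      (x = none ∧ y = none) ∨ ∃ a b : S, x = some a ∧ y = some b ∧ grJ (· * ·) a b) := by
  have R0 : leR (zMul Φ) none none := Or.inl rfl
  have L0 : leL (zMul Φ) none none := Or.inl rfl
  have J0 : leJ (zMul Φ) none none := Or.inl rfl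
  rcases x with _ | a <;> rcases y with _ | b <;>
    simp [grR, grL, grH, grD, grJ, Option.exists, leR_z hti, leL_z hti, leJ_z hti,
      leR_none, leL_none, leJ_none, R0, L0, J0]

end Stmt4
end

section
/- Let S be a semigroup, Φ a tight twisting on S, M a 𝒟-trivial additive commutative monoid, q ∈ M, and T = M ×_Φ^q S the twisted product. Then the set of idempotents of T is E(T) = {(i,e) ∈ M × S : i + i = i, e*e = e, and i = i + Φ(e,e)•q}. -/
namespace Stmt5

variable {α β : Type*}

/-- Green's `≤_ℛ` preorder for a binary operation `mul`. -/
def leR (mul : α → α → α) (a b : α) : Prop := a = b ∨ ∃ x, a = mul b x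

/-- Green's `≤_ℒ` preorder for a binary operation `mul`. -/
def leL (mul : α → α → α) (a b : α) : Prop := a = b ∨ ∃ x, a = mul x b

/-- Green's `≤_𝒥` preorder for a binary operation `mul`. -/
def leJ (mul : α → α → α) (a b : α) : Prop :=
  a = b ∨ (∃ x, a = mul x b) ∨ (∃ y, a = mul b y) ∨ ∃ x y, a = mul (mul x b) y

/-- Green's `ℛ` equivalence. -/
def grR (mul : α → α → α) (a b : α) : Prop := leR mul a b ∧ leR mul b a

/-- Green's `ℒ` equivalence. -/
def grL (mul : α → α → α) (a b : α) : Prop := leL mul a b ∧ leL mul b a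

/-- Green's `𝒥` equivalence. -/
def grJ (mul : α → α → α) (a b : α) : Prop := leJ mul a b ∧ leJ mul b a

/-- Green's `ℋ` equivalence. -/
def grH (mul : α → α → α) (a b : α) : Prop := grR mul a b ∧ grL mul a b

/-- Green's `𝒟` equivalence. -/
def grD (mul : α → α → α) (a b : α) : Prop := ∃ c, grR mul a c ∧ grL mul c b

/-- The `𝒟`-class of an element. -/
def Dclass (mul : α → α → α) (a : α) : Set α := {b | grD mul a b}

/-- The `ℋ`-class of an element. -/
def Hclass (mul : α → α → α) (a : α) : Set α := {b | grH mul a b}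

/-- The set of idempotents `E(X)` of a subset `X`. -/
def idemSet (mul : α → α → α) (X : Set α) : Set α := {e ∈ X | mul e e = e}

/-- A twisting on a semigroup `S`. -/
def Twisting {S : Type*} [Semigroup S] (Φ : S → S → ℕ) : Prop :=
  ∀ a b c : S, Φ a b + Φ (a * b) c = Φ a (b * c) + Φ b c

/-- A tight twisting. -/
def Tight {S : Type*} [Semigroup S] (Φ : S → S → ℕ) : Prop :=
  ∀ a b : S, (∃ a', a * b = a' * b ∧ Φ a' b = 0) ∧ ∃ b', a * b = a * b' ∧ Φ a b' = 0

/-- The multiplication of the twisted product `T = M ×_Φ^q S`. -/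
def twMul {S M : Type*} [Semigroup S] [AddCommMonoid M] (Φ : S → S → ℕ) (q : M)
    (x y : M × S) : M × S :=
  (x.1 + y.1 + Φ x.2 y.2 • q, x.2 * y.2)

/-- The multiplication of the `0`-twisted semigroup `T⁰` on `S ⊔ {0}`;
`none` plays the role of the zero element. -/
def zMul {S : Type*} [Semigroup S] (Φ : S → S → ℕ) : Option S → Option S → Option S
  | some a, some b => if Φ a b = 0 then some (a * b) else none
  | _, _ => none

/-- A `𝒟`-trivial additive commutative monoid. -/
def DTrivialAdd (M : Type*) [AddCommMonoid M] : Prop :=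
  ∀ i j : M, (∃ c, i = j + c) → (∃ d, j = i + d) → i = j

/-- Condition (★) for the `𝒟`-class of `(j, a)` in `T = M ×_Φ^q S`. -/
def CondStar {S M : Type*} [Semigroup S] [AddCommMonoid M]
    (Φ : S → S → ℕ) (q j : M) (a : S) : Prop :=
  (∃ e ∈ Dclass (· * ·) a, e * e = e ∧ 0 < Φ e e ∧ j = j + Φ e e • q) →
    ∀ f ∈ Dclass (· * ·) a, f * f = f → 0 < Φ f f → j = j + Φ f f • q

/-- `D₁ ≃ D₂`: a bijection preserving the `ℒ`- and `ℛ`-relations. -/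
def DSimeq {α β : Type*} (mul₁ : α → α → α) (mul₂ : β → β → β)
    (D₁ : Set α) (D₂ : Set β) : Prop :=
  ∃ Θ : α → β, Set.BijOn Θ D₁ D₂ ∧
    ∀ a ∈ D₁, ∀ b ∈ D₁,
      (grL mul₁ a b ↔ grL mul₂ (Θ a) (Θ b)) ∧ (grR mul₁ a b ↔ grR mul₂ (Θ a) (Θ b))

/-- `D₁ ≅ D₂`: a bijection preserving the `ℒ`- and `ℛ`-relations and the
(non)existence of idempotents in each `ℋ`-class. -/
def DCong {α β : Type*} (mul₁ : α → α → α) (mul₂ : β → β → β)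
    (D₁ : Set α) (D₂ : Set β) : Prop :=
  ∃ Θ : α → β, (Set.BijOn Θ D₁ D₂ ∧
    ∀ a ∈ D₁, ∀ b ∈ D₁,
      (grL mul₁ a b ↔ grL mul₂ (Θ a) (Θ b)) ∧ (grR mul₁ a b ↔ grR mul₂ (Θ a) (Θ b))) ∧
    ∀ a ∈ D₁,
      (idemSet mul₁ (Hclass mul₁ a ∩ D₁) = ∅ ↔
        idemSet mul₂ (Θ '' (Hclass mul₁ a ∩ D₁)) = ∅)

/-- For a tight twisting `Φ` on a semigroup `S`, a `𝒟`-trivial additive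
commutative monoid `M` and `q ∈ M`, the idempotents of the twisted product
`T = M ×_Φ^q S` are exactly the pairs `(i, e)` with `i` idempotent in `M`, `e` idempotent
in `S`, and `i = i + Φ(e,e) • q`. -/
theorem statement5 {S M : Type*} [Semigroup S] [AddCommMonoid M]
    (Φ : S → S → ℕ) (hco : Twisting Φ) (hti : Tight Φ)
    (hM : DTrivialAdd M) (q : M) :
    idemSet (twMul Φ q) Set.univ =
      {p : M × S | p.1 + p.1 = p.1 ∧ p.2 * p.2 = p.2 ∧ p.1 = p.1 + Φ p.2 p.2 • q} := by
  ext ⟨i, e⟩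
  simp only [idemSet, twMul, Set.mem_setOf_eq, Set.mem_univ, true_and, Prod.mk.injEq]
  constructor
  · rintro ⟨h, he⟩
    have hi : i = i + i := hM i (i + i) ⟨_, h.symm⟩ ⟨i, rfl⟩
    refine ⟨hi.symm, he, ?_⟩
    rw [← hi] at h
    exact h.symm
  · rintro ⟨hi, he, h⟩
    refine ⟨?_, he⟩
    rw [hi]
    exact h.symm

end Stmt5
end

section
/- Let S be a semigroup, Φ a tight twisting on S, M a 𝒟-trivial additive commutative monoid, q ∈ M, and T = M ×_Φ^q S the twisted product; let (j,a) ∈ T. If the 𝒟-class D^T_{(j,a)} of (j,a) in T contains an idempotent and j + q is idempotent in M (i.e. (j+q) + (j+q) = j+q), then Condition (★) holds for D^T_{(j,a)}. -/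
namespace Stmt8

variable {α β : Type*}

/-- Green's `≤_ℛ` preorder for a binary operation `mul`. -/
def leR (mul : α → α → α) (a b : α) : Prop := a = b ∨ ∃ x, a = mul b x

/-- Green's `≤_ℒ` preorder for a binary operation `mul`. -/
def leL (mul : α → α → α) (a b : α) : Prop := a = b ∨ ∃ x, a = mul x b

/-- Green's `≤_𝒥` preorder for a binary operation `mul`. -/
def leJ (mul : α → α → α) (a b : α) : Prop :=
  a = b ∨ (∃ x, a = mul x b) ∨ (∃ y, a = mul b y) ∨ ∃ x y, a = mul (mul x b) y

/-- Green's `ℛ` equivalence. -/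
def grR (mul : α → α → α) (a b : α) : Prop := leR mul a b ∧ leR mul b a

/-- Green's `ℒ` equivalence. -/
def grL (mul : α → α → α) (a b : α) : Prop := leL mul a b ∧ leL mul b a

/-- Green's `𝒥` equivalence. -/
def grJ (mul : α → α → α) (a b : α) : Prop := leJ mul a b ∧ leJ mul b a

/-- Green's `ℋ` equivalence. -/
def grH (mul : α → α → α) (a b : α) : Prop := grR mul a b ∧ grL mul a b

/-- Green's `𝒟` equivalence. -/
def grD (mul : α → α → α) (a b : α) : Prop := ∃ c, grR mul a c ∧ grL mul c b

/-- The `𝒟`-class of an element. -/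
def Dclass (mul : α → α → α) (a : α) : Set α := {b | grD mul a b}

/-- The `ℋ`-class of an element. -/
def Hclass (mul : α → α → α) (a : α) : Set α := {b | grH mul a b}

/-- The set of idempotents `E(X)` of a subset `X`. -/
def idemSet (mul : α → α → α) (X : Set α) : Set α := {e ∈ X | mul e e = e}

/-- A twisting on a semigroup `S`. -/
def Twisting {S : Type*} [Semigroup S] (Φ : S → S → ℕ) : Prop :=
  ∀ a b c : S, Φ a b + Φ (a * b) c = Φ a (b * c) + Φ b c

/-- A tight twisting. -/
def Tight {S : Type*} [Semigroup S] (Φ : S → S → ℕ) : Prop :=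
  ∀ a b : S, (∃ a', a * b = a' * b ∧ Φ a' b = 0) ∧ ∃ b', a * b = a * b' ∧ Φ a b' = 0

/-- The multiplication of the twisted product `T = M ×_Φ^q S`. -/
def twMul {S M : Type*} [Semigroup S] [AddCommMonoid M] (Φ : S → S → ℕ) (q : M)
    (x y : M × S) : M × S :=
  (x.1 + y.1 + Φ x.2 y.2 • q, x.2 * y.2)

/-- The multiplication of the `0`-twisted semigroup `T⁰` on `S ⊔ {0}`;
`none` plays the role of the zero element. -/
def zMul {S : Type*} [Semigroup S] (Φ : S → S → ℕ) : Option S → Option S → Option S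
  | some a, some b => if Φ a b = 0 then some (a * b) else none
  | _, _ => none

/-- A `𝒟`-trivial additive commutative monoid. -/
def DTrivialAdd (M : Type*) [AddCommMonoid M] : Prop :=
  ∀ i j : M, (∃ c, i = j + c) → (∃ d, j = i + d) → i = j

/-- Condition (★) for the `𝒟`-class of `(j, a)` in `T = M ×_Φ^q S`. -/
def CondStar {S M : Type*} [Semigroup S] [AddCommMonoid M]
    (Φ : S → S → ℕ) (q j : M) (a : S) : Prop :=
  (∃ e ∈ Dclass (· * ·) a, e * e = e ∧ 0 < Φ e e ∧ j = j + Φ e e • q) →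
    ∀ f ∈ Dclass (· * ·) a, f * f = f → 0 < Φ f f → j = j + Φ f f • q

/-- `D₁ ≃ D₂`: a bijection preserving the `ℒ`- and `ℛ`-relations. -/
def DSimeq {α β : Type*} (mul₁ : α → α → α) (mul₂ : β → β → β)
    (D₁ : Set α) (D₂ : Set β) : Prop :=
  ∃ Θ : α → β, Set.BijOn Θ D₁ D₂ ∧
    ∀ a ∈ D₁, ∀ b ∈ D₁,
      (grL mul₁ a b ↔ grL mul₂ (Θ a) (Θ b)) ∧ (grR mul₁ a b ↔ grR mul₂ (Θ a) (Θ b))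

/-- `D₁ ≅ D₂`: a bijection preserving the `ℒ`- and `ℛ`-relations and the
(non)existence of idempotents in each `ℋ`-class. -/
def DCong {α β : Type*} (mul₁ : α → α → α) (mul₂ : β → β → β)
    (D₁ : Set α) (D₂ : Set β) : Prop :=
  ∃ Θ : α → β, (Set.BijOn Θ D₁ D₂ ∧
    ∀ a ∈ D₁, ∀ b ∈ D₁,
      (grL mul₁ a b ↔ grL mul₂ (Θ a) (Θ b)) ∧ (grR mul₁ a b ↔ grR mul₂ (Θ a) (Θ b))) ∧
    ∀ a ∈ D₁,
      (idemSet mul₁ (Hclass mul₁ a ∩ D₁) = ∅ ↔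
        idemSet mul₂ (Θ '' (Hclass mul₁ a ∩ D₁)) = ∅)

/-- With `S`, `Φ` tight, `M` `𝒟`-trivial, `q ∈ M`, `T = M ×_Φ^q S` and
`(j, a) ∈ T`: if the `𝒟`-class of `(j, a)` in `T` contains an idempotent and `j + q` is
idempotent in `M`, then Condition (★) holds for the `𝒟`-class of `(j, a)`. -/
theorem statement8 {S M : Type*} [Semigroup S] [AddCommMonoid M]
    (Φ : S → S → ℕ) (hco : Twisting Φ) (hti : Tight Φ)
    (hM : DTrivialAdd M) (q j : M) (a : S)
    (hidem : (idemSet (twMul Φ q) (Dclass (twMul Φ q) (j, a))).Nonempty)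
    (hq : (j + q) + (j + q) = j + q) :
    CondStar Φ q j a := by
  rintro ⟨e, -, -, hpos, hj⟩ f - - -
  obtain ⟨n, hn⟩ : ∃ n, Φ e e = n + 1 := ⟨Φ e e - 1, by omega⟩
  have h1 : j = j + q := by
    refine hM j (j + q) ⟨n • q, ?_⟩ ⟨q, rfl⟩
    rw [hn, succ_nsmul'] at hj
    rw [add_assoc]
    exact hj
  have h2 : ∀ k : ℕ, j = j + k • q := by
    intro k
    induction k with
    | zero => simp
    | succ k ih => rw [succ_nsmul, ← add_assoc, ← ih]; exact h1
  exact h2 _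

end Stmt8
end

section
/- Let S be a semigroup and Φ a twisting on S. Then the multiplication of the 0-twisted semigroup T⁰ on S ⊔ {0} is associative; that is, T⁰ is a semigroup (with zero element 0). -/
namespace Stmt13

variable {α β : Type*}

/-- Green's `≤_ℛ` preorder for a binary operation `mul`. -/
def leR (mul : α → α → α) (a b : α) : Prop := a = b ∨ ∃ x, a = mul b x

/-- Green's `≤_ℒ` preorder for a binary operation `mul`. -/
def leL (mul : α → α → α) (a b : α) : Prop := a = b ∨ ∃ x, a = mul x b

/-- Green's `≤_𝒥` preorder for a binary operation `mul`. -/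
def leJ (mul : α → α → α) (a b : α) : Prop :=
  a = b ∨ (∃ x, a = mul x b) ∨ (∃ y, a = mul b y) ∨ ∃ x y, a = mul (mul x b) y

/-- Green's `ℛ` equivalence. -/
def grR (mul : α → α → α) (a b : α) : Prop := leR mul a b ∧ leR mul b a

/-- Green's `ℒ` equivalence. -/
def grL (mul : α → α → α) (a b : α) : Prop := leL mul a b ∧ leL mul b a

/-- Green's `𝒥` equivalence. -/
def grJ (mul : α → α → α) (a b : α) : Prop := leJ mul a b ∧ leJ mul b a

/-- Green's `ℋ` equivalence. -/
def grH (mul : α → α → α) (a b : α) : Prop := grR mul a b ∧ grL mul a b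

/-- Green's `𝒟` equivalence. -/
def grD (mul : α → α → α) (a b : α) : Prop := ∃ c, grR mul a c ∧ grL mul c b

/-- The `𝒟`-class of an element. -/
def Dclass (mul : α → α → α) (a : α) : Set α := {b | grD mul a b}

/-- The `ℋ`-class of an element. -/
def Hclass (mul : α → α → α) (a : α) : Set α := {b | grH mul a b}

/-- The set of idempotents `E(X)` of a subset `X`. -/
def idemSet (mul : α → α → α) (X : Set α) : Set α := {e ∈ X | mul e e = e}

/-- A twisting on a semigroup `S`. -/
def Twisting {S : Type*} [Semigroup S] (Φ : S → S → ℕ) : Prop :=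
  ∀ a b c : S, Φ a b + Φ (a * b) c = Φ a (b * c) + Φ b c

/-- A tight twisting. -/
def Tight {S : Type*} [Semigroup S] (Φ : S → S → ℕ) : Prop :=
  ∀ a b : S, (∃ a', a * b = a' * b ∧ Φ a' b = 0) ∧ ∃ b', a * b = a * b' ∧ Φ a b' = 0

/-- The multiplication of the twisted product `T = M ×_Φ^q S`. -/
def twMul {S M : Type*} [Semigroup S] [AddCommMonoid M] (Φ : S → S → ℕ) (q : M)
    (x y : M × S) : M × S :=
  (x.1 + y.1 + Φ x.2 y.2 • q, x.2 * y.2)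

/-- The multiplication of the `0`-twisted semigroup `T⁰` on `S ⊔ {0}`;
`none` plays the role of the zero element. -/
def zMul {S : Type*} [Semigroup S] (Φ : S → S → ℕ) : Option S → Option S → Option S
  | some a, some b => if Φ a b = 0 then some (a * b) else none
  | _, _ => none

/-- A `𝒟`-trivial additive commutative monoid. -/
def DTrivialAdd (M : Type*) [AddCommMonoid M] : Prop :=
  ∀ i j : M, (∃ c, i = j + c) → (∃ d, j = i + d) → i = j

/-- Condition (★) for the `𝒟`-class of `(j, a)` in `T = M ×_Φ^q S`. -/
def CondStar {S M : Type*} [Semigroup S] [AddCommMonoid M]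
    (Φ : S → S → ℕ) (q j : M) (a : S) : Prop :=
  (∃ e ∈ Dclass (· * ·) a, e * e = e ∧ 0 < Φ e e ∧ j = j + Φ e e • q) →
    ∀ f ∈ Dclass (· * ·) a, f * f = f → 0 < Φ f f → j = j + Φ f f • q

/-- `D₁ ≃ D₂`: a bijection preserving the `ℒ`- and `ℛ`-relations. -/
def DSimeq {α β : Type*} (mul₁ : α → α → α) (mul₂ : β → β → β)
    (D₁ : Set α) (D₂ : Set β) : Prop :=
  ∃ Θ : α → β, Set.BijOn Θ D₁ D₂ ∧
    ∀ a ∈ D₁, ∀ b ∈ D₁,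
      (grL mul₁ a b ↔ grL mul₂ (Θ a) (Θ b)) ∧ (grR mul₁ a b ↔ grR mul₂ (Θ a) (Θ b))

/-- `D₁ ≅ D₂`: a bijection preserving the `ℒ`- and `ℛ`-relations and the
(non)existence of idempotents in each `ℋ`-class. -/
def DCong {α β : Type*} (mul₁ : α → α → α) (mul₂ : β → β → β)
    (D₁ : Set α) (D₂ : Set β) : Prop :=
  ∃ Θ : α → β, (Set.BijOn Θ D₁ D₂ ∧
    ∀ a ∈ D₁, ∀ b ∈ D₁,
      (grL mul₁ a b ↔ grL mul₂ (Θ a) (Θ b)) ∧ (grR mul₁ a b ↔ grR mul₂ (Θ a) (Θ b))) ∧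
    ∀ a ∈ D₁,
      (idemSet mul₁ (Hclass mul₁ a ∩ D₁) = ∅ ↔
        idemSet mul₂ (Θ '' (Hclass mul₁ a ∩ D₁)) = ∅)

/-- For a twisting `Φ` on a semigroup `S`, the multiplication of the
`0`-twisted semigroup `T⁰` on `S ⊔ {0}` is associative, and `0` (here `none`) is a zero
element; that is, `T⁰` is a semigroup with zero. -/
theorem statement13 {S : Type*} [Semigroup S] (Φ : S → S → ℕ) (hco : Twisting Φ) :
    (∀ x y z : Option S, zMul Φ (zMul Φ x y) z = zMul Φ x (zMul Φ y z)) ∧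
    (∀ x : Option S, zMul Φ none x = none ∧ zMul Φ x none = none) := by
  have hl : ∀ x : Option S, zMul Φ none x = none := fun x => by cases x <;> rfl
  have hr : ∀ x : Option S, zMul Φ x none = none := fun x => by cases x <;> rfl
  have hs : ∀ a b : S, zMul Φ (some a) (some b) = if Φ a b = 0 then some (a * b) else none :=
    fun _ _ => rfl
  refine ⟨?_, fun x => ⟨hl x, hr x⟩⟩
  rintro (_ | a) (_ | b) (_ | c) <;> try simp only [hl, hr]
  have h := hco a b c
  rw [hs a b, hs b c]
  by_cases h1 : Φ a b = 0 <;> by_cases h2 : Φ b c = 0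
  · have h3 : Φ (a * b) c = Φ a (b * c) := by omega
    simp only [h1, h2, if_true, hs, h3, mul_assoc]
  · have h3 : Φ (a * b) c ≠ 0 := by omega
    simp only [h1, h2, if_true, if_false, hs, h3, hr]
  · have h3 : Φ a (b * c) ≠ 0 := by omega
    simp only [h1, h2, if_true, if_false, hs, h3, hl]
  · simp only [h1, h2, if_false, hl, hr]

end Stmt13
end

section
/- Let S be a semigroup, Φ a tight twisting on S, M a 𝒟-trivial additive commutative monoid, q ∈ M, and T = M ×_Φ^q S the twisted product. Then for every (j,a) ∈ T the 𝒟-class of (j,a) in T equals {j} × D_a^S, the projection Θ(j,u) = u is a bijection from D^T_{(j,a)} onto D_a^S witnessing D^T_{(j,a)} ≃ D_a^S, and the identity map witnesses D_a^S ≃ D_a^{T⁰}, where D_a^S is the 𝒟-class of a in S and D_a^{T⁰} is the 𝒟-class of a in the 0-twisted semigroup T⁰. -/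
namespace Stmt16

variable {α β : Type*}

/-- Green's `≤_ℛ` preorder for a binary operation `mul`. -/
def leR (mul : α → α → α) (a b : α) : Prop := a = b ∨ ∃ x, a = mul b x

/-- Green's `≤_ℒ` preorder for a binary operation `mul`. -/
def leL (mul : α → α → α) (a b : α) : Prop := a = b ∨ ∃ x, a = mul x b

/-- Green's `≤_𝒥` preorder for a binary operation `mul`. -/
def leJ (mul : α → α → α) (a b : α) : Prop :=
  a = b ∨ (∃ x, a = mul x b) ∨ (∃ y, a = mul b y) ∨ ∃ x y, a = mul (mul x b) y

/-- Green's `ℛ` equivalence. -/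
def grR (mul : α → α → α) (a b : α) : Prop := leR mul a b ∧ leR mul b a

/-- Green's `ℒ` equivalence. -/
def grL (mul : α → α → α) (a b : α) : Prop := leL mul a b ∧ leL mul b a

/-- Green's `𝒥` equivalence. -/
def grJ (mul : α → α → α) (a b : α) : Prop := leJ mul a b ∧ leJ mul b a

/-- Green's `ℋ` equivalence. -/
def grH (mul : α → α → α) (a b : α) : Prop := grR mul a b ∧ grL mul a b

/-- Green's `𝒟` equivalence. -/
def grD (mul : α → α → α) (a b : α) : Prop := ∃ c, grR mul a c ∧ grL mul c b

/-- The `𝒟`-class of an element. -/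
def Dclass (mul : α → α → α) (a : α) : Set α := {b | grD mul a b}

/-- The `ℋ`-class of an element. -/
def Hclass (mul : α → α → α) (a : α) : Set α := {b | grH mul a b}

/-- The set of idempotents `E(X)` of a subset `X`. -/
def idemSet (mul : α → α → α) (X : Set α) : Set α := {e ∈ X | mul e e = e}

/-- A twisting on a semigroup `S`. -/
def Twisting {S : Type*} [Semigroup S] (Φ : S → S → ℕ) : Prop :=
  ∀ a b c : S, Φ a b + Φ (a * b) c = Φ a (b * c) + Φ b c

/-- A tight twisting. -/
def Tight {S : Type*} [Semigroup S] (Φ : S → S → ℕ) : Prop :=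
  ∀ a b : S, (∃ a', a * b = a' * b ∧ Φ a' b = 0) ∧ ∃ b', a * b = a * b' ∧ Φ a b' = 0

/-- The multiplication of the twisted product `T = M ×_Φ^q S`. -/
def twMul {S M : Type*} [Semigroup S] [AddCommMonoid M] (Φ : S → S → ℕ) (q : M)
    (x y : M × S) : M × S :=
  (x.1 + y.1 + Φ x.2 y.2 • q, x.2 * y.2)

/-- The multiplication of the `0`-twisted semigroup `T⁰` on `S ⊔ {0}`;
`none` plays the role of the zero element. -/
def zMul {S : Type*} [Semigroup S] (Φ : S → S → ℕ) : Option S → Option S → Option S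
  | some a, some b => if Φ a b = 0 then some (a * b) else none
  | _, _ => none

/-- A `𝒟`-trivial additive commutative monoid. -/
def DTrivialAdd (M : Type*) [AddCommMonoid M] : Prop :=
  ∀ i j : M, (∃ c, i = j + c) → (∃ d, j = i + d) → i = j

/-- Condition (★) for the `𝒟`-class of `(j, a)` in `T = M ×_Φ^q S`. -/
def CondStar {S M : Type*} [Semigroup S] [AddCommMonoid M]
    (Φ : S → S → ℕ) (q j : M) (a : S) : Prop :=
  (∃ e ∈ Dclass (· * ·) a, e * e = e ∧ 0 < Φ e e ∧ j = j + Φ e e • q) →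
    ∀ f ∈ Dclass (· * ·) a, f * f = f → 0 < Φ f f → j = j + Φ f f • q

/-- `D₁ ≃ D₂`: a bijection preserving the `ℒ`- and `ℛ`-relations. -/
def DSimeq {α β : Type*} (mul₁ : α → α → α) (mul₂ : β → β → β)
    (D₁ : Set α) (D₂ : Set β) : Prop :=
  ∃ Θ : α → β, Set.BijOn Θ D₁ D₂ ∧
    ∀ a ∈ D₁, ∀ b ∈ D₁,
      (grL mul₁ a b ↔ grL mul₂ (Θ a) (Θ b)) ∧ (grR mul₁ a b ↔ grR mul₂ (Θ a) (Θ b))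

/-- `D₁ ≅ D₂`: a bijection preserving the `ℒ`- and `ℛ`-relations and the
(non)existence of idempotents in each `ℋ`-class. -/
def DCong {α β : Type*} (mul₁ : α → α → α) (mul₂ : β → β → β)
    (D₁ : Set α) (D₂ : Set β) : Prop :=
  ∃ Θ : α → β, (Set.BijOn Θ D₁ D₂ ∧
    ∀ a ∈ D₁, ∀ b ∈ D₁,
      (grL mul₁ a b ↔ grL mul₂ (Θ a) (Θ b)) ∧ (grR mul₁ a b ↔ grR mul₂ (Θ a) (Θ b))) ∧
    ∀ a ∈ D₁,
      (idemSet mul₁ (Hclass mul₁ a ∩ D₁) = ∅ ↔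
        idemSet mul₂ (Θ '' (Hclass mul₁ a ∩ D₁)) = ∅)

theorem twR_aux {S M : Type*} [Semigroup S] [AddCommMonoid M]
    (Φ : S → S → ℕ) (hti : Tight Φ) (hM : DTrivialAdd M) (q : M) (x y : M × S) :
    grR (twMul Φ q) x y ↔ x.1 = y.1 ∧ grR (· * ·) x.2 y.2 := by
  have h1 : ∀ x y : M × S, leR (twMul Φ q) x y →
      (∃ c, x.1 = y.1 + c) ∧ leR (· * ·) x.2 y.2 := by
    rintro x y (rfl | ⟨z, rfl⟩)
    · exact ⟨⟨0, by simp⟩, Or.inl rfl⟩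
    · exact ⟨⟨z.1 + Φ y.2 z.2 • q, by simp [twMul, add_assoc]⟩, Or.inr ⟨z.2, rfl⟩⟩
  have h2 : ∀ (m : M) (u v : S), leR (· * ·) u v → leR (twMul Φ q) (m, u) (m, v) := by
    rintro m u v (rfl | ⟨z, rfl⟩)
    · exact Or.inl rfl
    · obtain ⟨b, hb, h0⟩ := (hti v z).2
      exact Or.inr ⟨(0, b), by simp [twMul, h0, hb]⟩
  constructor
  · rintro ⟨h, h'⟩
    exact ⟨hM _ _ (h1 _ _ h).1 (h1 _ _ h').1, (h1 _ _ h).2, (h1 _ _ h').2⟩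
  · obtain ⟨m, u⟩ := x
    obtain ⟨n, v⟩ := y
    rintro ⟨h, h', h''⟩
    obtain rfl : m = n := h
    exact ⟨h2 _ _ _ h', h2 _ _ _ h''⟩

theorem twL_aux {S M : Type*} [Semigroup S] [AddCommMonoid M]
    (Φ : S → S → ℕ) (hti : Tight Φ) (hM : DTrivialAdd M) (q : M) (x y : M × S) :
    grL (twMul Φ q) x y ↔ x.1 = y.1 ∧ grL (· * ·) x.2 y.2 := by
  have h1 : ∀ x y : M × S, leL (twMul Φ q) x y →
      (∃ c, x.1 = y.1 + c) ∧ leL (· * ·) x.2 y.2 := by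
    rintro x y (rfl | ⟨z, rfl⟩)
    · exact ⟨⟨0, by simp⟩, Or.inl rfl⟩
    · exact ⟨⟨z.1 + Φ z.2 y.2 • q, by simp only [twMul]; abel⟩, Or.inr ⟨z.2, rfl⟩⟩
  have h2 : ∀ (m : M) (u v : S), leL (· * ·) u v → leL (twMul Φ q) (m, u) (m, v) := by
    rintro m u v (rfl | ⟨z, rfl⟩)
    · exact Or.inl rfl
    · obtain ⟨b, hb, h0⟩ := (hti z v).1
      exact Or.inr ⟨(0, b), by simp [twMul, h0, hb]⟩
  constructor
  · rintro ⟨h, h'⟩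
    exact ⟨hM _ _ (h1 _ _ h).1 (h1 _ _ h').1, (h1 _ _ h).2, (h1 _ _ h').2⟩
  · obtain ⟨m, u⟩ := x
    obtain ⟨n, v⟩ := y
    rintro ⟨h, h', h''⟩
    obtain rfl : m = n := h
    exact ⟨h2 _ _ _ h', h2 _ _ _ h''⟩

theorem zleR_aux {S : Type*} [Semigroup S] (Φ : S → S → ℕ) (hti : Tight Φ) (u v : S) :
    leR (zMul Φ) (some u) (some v) ↔ leR (· * ·) u v := by
  constructor
  · rintro (h | ⟨_ | z, h⟩)
    · exact Or.inl (Option.some.inj h)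
    · simp [zMul] at h
    · simp only [zMul] at h
      split_ifs at h
      exact Or.inr ⟨z, Option.some.inj h⟩
  · rintro (rfl | ⟨z, rfl⟩)
    · exact Or.inl rfl
    · obtain ⟨b, hb, h0⟩ := (hti v z).2
      exact Or.inr ⟨some b, by simp [zMul, h0, hb]⟩

theorem zleL_aux {S : Type*} [Semigroup S] (Φ : S → S → ℕ) (hti : Tight Φ) (u v : S) :
    leL (zMul Φ) (some u) (some v) ↔ leL (· * ·) u v := by
  constructor
  · rintro (h | ⟨_ | z, h⟩)
    · exact Or.inl (Option.some.inj h)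
    · simp [zMul] at h
    · simp only [zMul] at h
      split_ifs at h
      exact Or.inr ⟨z, Option.some.inj h⟩
  · rintro (rfl | ⟨z, rfl⟩)
    · exact Or.inl rfl
    · obtain ⟨b, hb, h0⟩ := (hti z v).1
      exact Or.inr ⟨some b, by simp [zMul, h0, hb]⟩

theorem zR_aux {S : Type*} [Semigroup S] (Φ : S → S → ℕ) (hti : Tight Φ) (u v : S) :
    grR (zMul Φ) (some u) (some v) ↔ grR (· * ·) u v := by
  simp only [grR, zleR_aux Φ hti]

theorem zL_aux {S : Type*} [Semigroup S] (Φ : S → S → ℕ) (hti : Tight Φ) (u v : S) :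
    grL (zMul Φ) (some u) (some v) ↔ grL (· * ·) u v := by
  simp only [grL, zleL_aux Φ hti]

theorem zR_none {S : Type*} [Semigroup S] (Φ : S → S → ℕ) (u : S) :
    ¬ grR (zMul Φ) (some u) none := by
  rintro ⟨h | ⟨z, h⟩, -⟩ <;> simp [zMul] at h

theorem zL_none {S : Type*} [Semigroup S] (Φ : S → S → ℕ) (u : S) :
    ¬ grL (zMul Φ) (some u) none := by
  rintro ⟨h | ⟨_ | z, h⟩, -⟩ <;> simp [zMul] at h

/-- Let `S` be a semigroup, `Φ` a tight twisting on `S`, `M` a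
`𝒟`-trivial additive commutative monoid, `q ∈ M`, and `T = M ×_Φ^q S`. For every
`(j, a) ∈ T`: the `𝒟`-class of `(j, a)` in `T` equals `{j} × D_a^S`; the projection
`Θ(j, u) = u` is a bijection onto `D_a^S` preserving the `ℒ`- and `ℛ`-relations
(witnessing `D^T_{(j,a)} ≃ D_a^S`); and the identity map (i.e. `some : S → T⁰`)
witnesses `D_a^S ≃ D_a^{T⁰}`. -/
theorem statement16 {S M : Type*} [Semigroup S] [AddCommMonoid M]
    (Φ : S → S → ℕ) (hco : Twisting Φ) (hti : Tight Φ)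
    (hM : DTrivialAdd M) (q j : M) (a : S) :
    Dclass (twMul Φ q) (j, a) = {p : M × S | p.1 = j ∧ p.2 ∈ Dclass (· * ·) a} ∧
    (Set.BijOn Prod.snd (Dclass (twMul Φ q) (j, a)) (Dclass (· * ·) a) ∧
      ∀ x ∈ Dclass (twMul Φ q) (j, a), ∀ y ∈ Dclass (twMul Φ q) (j, a),
        (grL (twMul Φ q) x y ↔ grL (· * ·) x.2 y.2) ∧
        (grR (twMul Φ q) x y ↔ grR (· * ·) x.2 y.2)) ∧
    (Set.BijOn (fun s : S => (some s : Option S)) (Dclass (· * ·) a)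
        (Dclass (zMul Φ) (some a)) ∧
      ∀ x ∈ Dclass (· * ·) a, ∀ y ∈ Dclass (· * ·) a,
        (grL (· * ·) x y ↔ grL (zMul Φ) (some x) (some y)) ∧
        (grR (· * ·) x y ↔ grR (zMul Φ) (some x) (some y))) := by
  have key : Dclass (twMul Φ q) (j, a) = {p : M × S | p.1 = j ∧ p.2 ∈ Dclass (· * ·) a} := by
    ext ⟨m, u⟩
    simp only [Dclass, grD, Set.mem_setOf_eq, twR_aux Φ hti hM, twL_aux Φ hti hM]
    constructor
    · rintro ⟨⟨n, c⟩, ⟨h1, h2⟩, h3, h4⟩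
      exact ⟨(h1.trans h3).symm, c, h2, h4⟩
    · rintro ⟨rfl, c, h2, h4⟩
      exact ⟨(m, c), ⟨rfl, h2⟩, rfl, h4⟩
  refine ⟨key, ⟨?_, ?_⟩, ⟨?_, ?_⟩⟩
  · rw [key]
    refine ⟨fun p hp => hp.2, ?_, fun u hu => ⟨(j, u), ⟨rfl, hu⟩, rfl⟩⟩
    rintro p ⟨hp, -⟩ r ⟨hr, -⟩ h
    exact Prod.ext (hp.trans hr.symm) h
  · rw [key]
    rintro p ⟨hp, -⟩ r ⟨hr, -⟩
    have e := hp.trans hr.symm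
    rw [twR_aux Φ hti hM, twL_aux Φ hti hM]
    exact ⟨and_iff_right e, and_iff_right e⟩
  · refine ⟨?_, fun u _ v _ h => Option.some.inj h, ?_⟩
    · rintro u ⟨c, h1, h2⟩
      exact ⟨some c, (zR_aux Φ hti _ _).2 h1, (zL_aux Φ hti _ _).2 h2⟩
    · rintro u ⟨_ | c, h1, h2⟩
      · exact (zR_none Φ _ h1).elim
      · cases u with
        | none => exact (zL_none Φ _ h2).elim
        | some u => exact ⟨u, ⟨c, (zR_aux Φ hti _ _).1 h1, (zL_aux Φ hti _ _).1 h2⟩, rfl⟩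
  · intro x _ y _
    exact ⟨(zL_aux Φ hti _ _).symm, (zR_aux Φ hti _ _).symm⟩

end Stmt16
end

section
/- For integers n ≥ 1 and 0 ≤ k ≤ n with k ≡ n (mod 2), let c = (n−k)/2 and define a(n,k) = ((n−2c+1)/(n−c+1)) · binom(n,c); set a(n,k) = 0 whenever k < 0, k > n, or k ≢ n (mod 2). Define b(n,0) = 0, b(n,k) = a(n−1, k−1) for even k ≥ 2, and b(n,k) = a(n,k) for odd k, and set b(n) = Σ_{k=0}^{n} b(n,k). (By the paper, b(n,k) is the dimension of the simple module L^n_k of the Temperley–Lieb algebra TL_0(n) at δ = 0, i.e. at l = 2.) Then b(n) ~ ((3+(−1)^{n+1})/4) · √(2/π) · n^{−1/2} · 2^n as n → ∞; equivalently, √n · b(n)/2^n → √(2/π) along odd n and √n · b(n)/2^n → (1/2)·√(2/π) along even n. -/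
namespace Stmt19

open Filter

/-- The dimension `a(n,k)` of the Temperley–Lieb cell module `Δ^n_k`:
for `0 ≤ k ≤ n` with `k ≡ n (mod 2)` and `c = (n−k)/2` it is
`((n−2c+1)/(n−c+1))·binom(n,c)`, and it is `0` otherwise. -/
noncomputable def aTL (n k : ℕ) : ℝ :=
  if k ≤ n ∧ n % 2 = k % 2 then
    (((n : ℝ) - 2 * (((n - k) / 2 : ℕ) : ℝ) + 1) / ((n : ℝ) - (((n - k) / 2 : ℕ) : ℝ) + 1)) *
      (n.choose ((n - k) / 2) : ℝ)
  else 0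

/-- The dimension `b(n,k)` of the simple module `L^n_k` of the Temperley–Lieb algebra
`TL_0(n)` at `δ = 0` (i.e. `l = 2`): `b(n,0) = 0`, `b(n,k) = a(n−1,k−1)` for even
`k ≥ 2`, and `b(n,k) = a(n,k)` for odd `k`. -/
noncomputable def bTL (n k : ℕ) : ℝ :=
  if k = 0 then 0 else if k % 2 = 0 then aTL (n - 1) (k - 1) else aTL n k

/-- `b(n) = Σ_{k=0}^n b(n,k)`, the total dimension of the simple `TL_0(n)`-modules. -/
noncomputable def bTLsum (n : ℕ) : ℝ := ∑ k ∈ Finset.range (n + 1), bTL n k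

theorem sum_aux (m j : ℕ) (hj : j ≤ m) :
    ∑ c ∈ Finset.range (j + 1), aTL (2 * m + 1) (2 * (m - c) + 1) = ((2 * m + 1).choose j : ℝ) := by
  induction j with
  | zero =>
    have h1 : (2 * m + 1 - (2 * m + 1)) / 2 = 0 := by omega
    have h2 : (2 * (m : ℝ) + 1 + 1) ≠ 0 := by positivity
    simp [aTL, div_self h2]
  | succ j ih =>
    rw [Finset.sum_range_succ, ih (by omega)]
    have h1 : (2 * m + 1 - (2 * (m - (j + 1)) + 1)) / 2 = j + 1 := by omega
    have h2 : 2 * (m - (j + 1)) + 1 ≤ 2 * m + 1 ∧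
      (2 * m + 1) % 2 = (2 * (m - (j + 1)) + 1) % 2 := by omega
    have h3 := Nat.choose_succ_right_eq (2 * m + 1) j
    have h4 : ((2 * m + 1 - j : ℕ) : ℝ) = 2 * m + 1 - j := by
      rw [Nat.cast_sub (by omega)]; push_cast; ring
    have h5 : ((2 * m + 1).choose (j + 1) : ℝ) * (j + 1) =
        ((2 * m + 1).choose j : ℝ) * (2 * m + 1 - j) := by
      rw [← h4]; exact_mod_cast h3
    have h6 : (0 : ℝ) < 2 * m + 1 - j := by
      have : (j : ℝ) + 1 ≤ m := by exact_mod_cast hj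
      linarith [(Nat.cast_nonneg j : (0 : ℝ) ≤ j)]
    rw [aTL, if_pos h2, h1]
    push_cast
    have h7 : (2 * (m : ℝ) + 1 - (j + 1) + 1) = 2 * m + 1 - j := by ring
    rw [h7]
    field_simp
    linear_combination -h5

theorem sum_a (m : ℕ) :
    ∑ i ∈ Finset.range (m + 1), aTL (2 * m + 1) (2 * i + 1) = ((2 * m + 1).choose m : ℝ) := by
  rw [← sum_aux m m le_rfl, ← Finset.sum_range_reflect]
  simp

theorem sum_pairs (f : ℕ → ℝ) (j : ℕ) :
    ∑ k ∈ Finset.range (2 * j), f k = ∑ i ∈ Finset.range j, (f (2 * i) + f (2 * i + 1)) := by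
  induction j with
  | zero => simp
  | succ j ih =>
    rw [Nat.mul_succ, Finset.sum_range_succ, Finset.sum_range_succ, Finset.sum_range_succ, ih]
    ring

theorem b_odd (m : ℕ) : bTLsum (2 * m + 1) = ((2 * m + 1).choose m : ℝ) := by
  rw [← sum_a, bTLsum, show 2 * m + 1 + 1 = 2 * (m + 1) by ring, sum_pairs]
  refine Finset.sum_congr rfl fun i _ => ?_
  have e1 : bTL (2 * m + 1) (2 * i) = 0 := by
    unfold bTL
    split_ifs with h h'
    · rfl
    · rw [aTL, if_neg (by omega)]
    · omega
  have e2 : bTL (2 * m + 1) (2 * i + 1) = aTL (2 * m + 1) (2 * i + 1) := by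
    rw [bTL, if_neg (by omega), if_neg (by omega)]
  rw [e1, e2, zero_add]

theorem b_even (m : ℕ) : bTLsum (2 * (m + 1)) = ((2 * m + 1).choose m : ℝ) := by
  rw [← sum_a, bTLsum, Finset.sum_range_succ', sum_pairs]
  have e0 : bTL (2 * (m + 1)) 0 = 0 := by simp [bTL]
  rw [e0, add_zero]
  refine Finset.sum_congr rfl fun i _ => ?_
  have e1 : bTL (2 * (m + 1)) (2 * i + 1) = 0 := by
    rw [bTL, if_neg (by omega), if_neg (by omega), aTL, if_neg (by omega)]
  have e2 : bTL (2 * (m + 1)) (2 * i + 1 + 1) = aTL (2 * m + 1) (2 * i + 1) := by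
    rw [bTL, if_neg (by omega), if_pos (by omega)]
    rfl
  rw [e1, e2, zero_add]

theorem choose_mid (m : ℕ) :
    2 * ((2 * m + 1).choose m : ℝ) = (Nat.centralBinom (m + 1) : ℝ) := by
  have h := Nat.choose_symm_half m
  have h' := Nat.choose_succ_succ (2 * m + 1) m
  rw [Nat.centralBinom, show 2 * (m + 1) = 2 * m + 1 + 1 by ring, h']
  push_cast
  rw [h]; ring

theorem central_lim : Tendsto
    (fun m : ℕ => Real.sqrt (2 * m + 1) * (Nat.centralBinom m : ℝ) / 4 ^ m) atTop
    (nhds (Real.sqrt (2 / Real.pi))) := by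
  have h := (Real.Wallis.tendsto_W_nhds_pi_div_two.inv₀ (by positivity)).sqrt
  rw [inv_div] at h
  refine h.congr fun m => ?_
  rw [Real.Wallis.W_eq_factorial_ratio]
  have hf : ((2 * m).factorial : ℝ) = Nat.centralBinom m * (m.factorial : ℝ) ^ 2 := by
    have := Nat.choose_mul_factorial_mul_factorial (n := 2 * m) (k := m) (by omega)
    rw [show 2 * m - m = m by omega] at this
    rw [Nat.centralBinom, ← this]; push_cast; ring
  rw [hf]
  have hp : (0 : ℝ) < m.factorial := by positivity
  rw [Real.sqrt_eq_iff_mul_self_eq (by positivity) (by positivity)]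
  have hs : Real.sqrt (2 * m + 1) * Real.sqrt (2 * m + 1) = 2 * m + 1 :=
    Real.mul_self_sqrt (by positivity)
  have h4 : (2 : ℝ) ^ (4 * m) = 4 ^ m * 4 ^ m := by
    rw [← mul_pow, pow_mul]; norm_num
  rw [h4, div_mul_div_comm, mul_mul_mul_comm, hs]
  field_simp

theorem ratio_lim : Tendsto (fun m : ℕ => (2 * (m : ℝ) + 1) / (2 * m + 2)) atTop (nhds 1) := by
  have h : Tendsto (fun m : ℕ => 1 - (1 / 2) * (1 / ((m : ℝ) + 1))) atTop
      (nhds (1 - (1 / 2) * 0)) :=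
    tendsto_const_nhds.sub (tendsto_one_div_add_atTop_nhds_zero_nat.const_mul _)
  rw [mul_zero, sub_zero] at h
  refine h.congr fun m => ?_
  field_simp
  ring

theorem ratio_lim' : Tendsto (fun m : ℕ => (2 * (m : ℝ)) / (2 * m + 1)) atTop (nhds 1) := by
  have h := (Stirling.tendsto_self_div_two_mul_self_add_one).const_mul 2
  norm_num at h
  refine h.congr fun m => ?_
  ring

/-- `b(n) ~ ((3+(−1)^{n+1})/4) · √(2/π) · n^{−1/2} · 2^n` as `n → ∞`;
equivalently, `√n · b(n)/2^n → √(2/π)` along odd `n` and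
`√n · b(n)/2^n → (1/2)·√(2/π)` along even `n`. -/
theorem statement19 :
    Tendsto (fun m : ℕ => Real.sqrt ((2 * m + 1 : ℕ) : ℝ) * bTLsum (2 * m + 1) / 2 ^ (2 * m + 1))
      atTop (nhds (Real.sqrt (2 / Real.pi))) ∧
    Tendsto (fun m : ℕ => Real.sqrt ((2 * m : ℕ) : ℝ) * bTLsum (2 * m) / 2 ^ (2 * m))
      atTop (nhds ((1 / 2) * Real.sqrt (2 / Real.pi))) := by
  constructor
  · have h := central_lim.mul ratio_lim
    rw [mul_one] at h
    refine h.congr fun m => ?_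
    rw [b_odd]
    have h1 := choose_mid m
    have h2 : ((m : ℝ) + 1) * Nat.centralBinom (m + 1) =
        2 * (2 * m + 1) * Nat.centralBinom m := by
      exact_mod_cast Nat.succ_mul_centralBinom_succ m
    rw [← h1] at h2
    have h4 : (2 : ℝ) ^ (2 * m + 1) = 2 * 4 ^ m := by
      rw [pow_succ, pow_mul]; norm_num; ring
    rw [h4]
    push_cast
    field_simp
    linear_combination (-1 / 2 : ℝ) * h2
  · have h := (central_lim.mul ratio_lim'.sqrt).const_mul (1 / 2)
    rw [Real.sqrt_one, mul_one] at h
    refine h.congr' ?_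
    filter_upwards [eventually_ge_atTop 1] with m hm
    obtain ⟨m, rfl⟩ := Nat.exists_eq_add_of_le' hm
    rw [b_even, ← choose_mid, Real.sqrt_div (by positivity), pow_mul]
    norm_num
    have : Real.sqrt (2 * ((m : ℝ) + 1) + 1) ≠ 0 := by positivity
    field_simp

end Stmt19
end
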